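/- arXiv:2105.06308 — 2 statements merged into one kernel-verified Lean document; each statement's English description precedes it below -/
import Mathlib

section
/- Let C ⊆ Curves_ℤ be a line set. If Θ_ℤ(C) is an interval in QP¹, then Θ_ℤ(C) = Θ_{ℤ/2}(C). -/
open OnePoint

/-- The space of slopes `QP¹ = ℚ ∪ {∞}`. -/
abbrev QP1 : Type := OnePoint ℚ

/-- `Incr3 x y z` means `(x,y,z)` is an increasing triple of pairwise distinct slopes
in the counter-clockwise cyclic order on `QP¹`. -/
def Incr3 : QP1 → QP1 → QP1 → Prop
  | Option.some a, Option.some b, Option.some c =>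
      (a < b ∧ b < c) ∨ (b < c ∧ c < a) ∨ (c < a ∧ a < b)
  | Option.some a, Option.some b, Option.none => a < b
  | Option.some a, Option.none, Option.some c => c < a
  | Option.none, Option.some b, Option.some c => b < c
  | _, _, _ => False

/-- A line: a slope together with a grading in `G` and a bit `ε`, which is `false`
for rational lines and `true` for special ones. -/
structure Line (G : Type*) where
  slope : QP1
  grade : G
  eps : Bool

/-- The `G`-action on lines: `n · (s, g, ε) = (s, g + n, ε)`. -/
def Line.shift {G : Type*} [Add G] (c : Line G) (n : G) : Line G :=
  ⟨c.slope, c.grade + n, c.eps⟩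

/-- The axioms (symmetry, transitivity, linearity) for a grading function. -/
structure IsGradingFunction {G : Type*} [CommRing G] (gr : Line G → Line G → G) : Prop where
  symm_eq : ∀ c c' : Line G, c.slope = c'.slope → gr c c' + gr c' c = 0
  symm_ne : ∀ c c' : Line G, c.slope ≠ c'.slope → gr c c' + gr c' c = -1
  trans : ∀ c c' c'' : Line G, Incr3 c.slope c'.slope c''.slope →
      gr c c' + gr c' c'' = gr c c''
  linear : ∀ (n n' : G) (c c' : Line G),
      gr (c.shift n) (c'.shift n') = gr c c' + n' - n

/-- `G ∈ {ℤ, ℤ/2}`. -/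
def GoodG (G : Type*) [CommRing G] : Prop :=
  Nonempty (G ≃+* ℤ) ∨ Nonempty (G ≃+* ZMod 2)

/-- The set of supporting slopes of a set of lines. -/
def SlopesOf {G : Type*} (C : Set (Line G)) : Set QP1 := Line.slope '' C

/-- `C` is `s`-rational: every line in `C` of slope `s` is rational. -/
def SRational {G : Type*} (C : Set (Line G)) (s : QP1) : Prop :=
  ∀ c ∈ C, c.slope = s → c.eps = false

/-- `C` is `s`-special: every line in `C` of slope `s` is special. -/
def SSpecial {G : Type*} (C : Set (Line G)) (s : QP1) : Prop :=
  ∀ c ∈ C, c.slope = s → c.eps = true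

/-- `C` is `s`-consistent with respect to the grading function `gr`. -/
def Consistent {G : Type*} [CommRing G] (gr : Line G → Line G → G) (C : Set (Line G)) (s : QP1) :
    Prop :=
  ∀ c ∈ C, ∀ c' ∈ C, c.slope = s → c'.slope = s → gr c c' = 0

/-- A trivial line set: all lines special and concentrated in a single slope. -/
def TrivialLineSet {G : Type*} (C : Set (Line G)) : Prop :=
  ∃ s : QP1, SlopesOf C = {s} ∧ SSpecial C s

/-- The pair `(C, D)` is thin with respect to `gr`. -/
def ThinPair {G : Type*} [CommRing G] (gr : Line G → Line G → G) (C D : Set (Line G)) : Prop :=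
  ∃ n : G, ∀ c ∈ C, ∀ d ∈ D,
    (c.slope = d.slope → c.eps ≠ d.eps) ∧ (c.slope ≠ d.slope → gr c d = n)

/-- The thin filling space `Θ(C)` of a set of lines. -/
def Theta {G : Type*} [CommRing G] (gr : Line G → Line G → G) (C : Set (Line G)) :
    Set QP1 :=
  {s | ThinPair gr {⟨s, 0, false⟩} C}

open scoped Classical in
/-- The open interval `(a, b)` in `QP¹`, with the convention `(a, a) = QP¹ ∖ {a}`. -/
noncomputable def Intvl (a b : QP1) : Set QP1 :=
  if a = b then {a}ᶜ else {s | Incr3 a s b}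

/-- An interval in `QP¹`: one of `(a,b)`, `[a,b)`, `(a,b]`, `[a,b]`, containing
at least two points. -/
def IsInterval (X : Set QP1) : Prop :=
  X.Nontrivial ∧ ∃ a b : QP1,
    X = Intvl a b ∨ X = insert a (Intvl a b) ∨ X = insert b (Intvl a b) ∨
      X = insert a (insert b (Intvl a b))

/-- Exceptional line sets. -/
def Exceptional {G : Type*} [CommRing G] (gr : Line G → Line G → G) (C : Set (Line G)) : Prop :=
  ∃ s s' : QP1, s ≠ s' ∧ SlopesOf C = {s, s'} ∧
    Consistent gr C s ∧ Consistent gr C s' ∧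
    ∃ c ∈ C, ∃ c' ∈ C, c.slope = s ∧ c'.slope = s' ∧ gr c c' ≠ 0 ∧ gr c' c ≠ 0

/-- Reduction of lines modulo 2: `(s, g, ε) ↦ (s, g mod 2, ε)`. -/
def redLine (c : Line ℤ) : Line (ZMod 2) := ⟨c.slope, (c.grade : ZMod 2), c.eps⟩

/-- Totality of the cyclic order. -/
theorem incr3_total (a b c : QP1) (hab : a ≠ b) (hac : a ≠ c) (hbc : b ≠ c) :
    Incr3 a b c ∨ Incr3 a c b := by
  rcases a with _ | a <;> rcases b with _ | b <;> rcases c with _ | c <;>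
    simp only [Incr3] <;> first
    | exact absurd rfl hab
    | exact absurd rfl hac
    | exact absurd rfl hbc
    | skip
  · have : b ≠ c := fun h => hbc (h ▸ rfl)
    exact lt_or_gt_of_ne this
  · have : a ≠ c := fun h => hac (h ▸ rfl)
    exact (lt_or_gt_of_ne this).symm
  · have : a ≠ b := fun h => hab (h ▸ rfl)
    exact lt_or_gt_of_ne this
  · have h1 : b ≠ c := fun h => hbc (h ▸ rfl)
    have h2 : a ≠ c := fun h => hac (h ▸ rfl)
    have h3 : a ≠ b := fun h => hab (h ▸ rfl)
    rcases lt_or_gt_of_ne h1 with h1 | h1 <;> rcases lt_or_gt_of_ne h2 with h2 | h2 <;>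
      rcases lt_or_gt_of_ne h3 with h3 | h3 <;> simp [h1, h2, h3] <;> linarith

/-- Open intervals are infinite. -/
theorem intvl_infinite (a b : QP1) : (Intvl a b).Infinite := by
  have key : ∀ S : Set ℚ, S.Infinite → (∀ x ∈ S, (Option.some x : QP1) ∈ Intvl a b) →
      (Intvl a b).Infinite := by
    intro S hS h
    have h2 : ((fun x : ℚ => (Option.some x : QP1)) '' S).Infinite :=
      hS.image (fun x _ y _ hxy => Option.some.inj hxy)
    refine h2.mono ?_
    rintro _ ⟨x, hx, rfl⟩
    exact h x hx
  by_cases hab : a = b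
  · subst hab
    simp only [Intvl, if_true]
    haveI : Infinite QP1 := Infinite.of_injective (fun x : ℚ => (Option.some x : QP1))
      (fun x y hxy => Option.some.inj hxy)
    exact (Set.finite_singleton a).infinite_compl
  · simp only [Intvl, if_neg hab] at key ⊢
    rcases a with _ | a <;> rcases b with _ | b
    · exact absurd rfl hab
    · exact key (Set.Iio b) (Set.Iio_infinite b) (fun x hx => hx)
    · exact key (Set.Ioi a) (Set.Ioi_infinite a) (fun x hx => hx)
    · have h3 : a ≠ b := fun h => hab (h ▸ rfl)
      rcases lt_or_gt_of_ne h3 with h | h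
      · exact key (Set.Ioo a b) (Set.Ioo_infinite h) (fun x hx => Or.inl hx)
      · exact key (Set.Ioi a) (Set.Ioi_infinite a) (fun x hx => Or.inr (Or.inr ⟨h, hx⟩))

/-- Differences of gradings seen from two test lines differ by at most one. -/
theorem grade_diff (gr : Line ℤ → Line ℤ → ℤ) (hgr : IsGradingFunction gr)
    (S T c c' : Line ℤ) (hSc : S.slope ≠ c.slope) (hSc' : S.slope ≠ c'.slope)
    (hTc : T.slope ≠ c.slope) (hTc' : T.slope ≠ c'.slope) (hne : S.slope ≠ T.slope)
    (h : gr T c = gr T c') :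
    gr S c - gr S c' = 0 ∨ gr S c - gr S c' = 1 ∨ gr S c - gr S c' = -1 := by
  by_cases hcc : c.slope = c'.slope
  · left
    rcases incr3_total S.slope T.slope c.slope hne hSc hTc with hi | hi
    · have h1 := hgr.trans _ _ _ hi
      have h2 := hgr.trans S T c' (hcc ▸ hi)
      omega
    · have h1 := hgr.trans S c T hi
      have h2 := hgr.trans S c' T (hcc ▸ hi)
      have h3 := hgr.symm_ne _ _ hTc
      have h4 := hgr.symm_ne _ _ hTc'
      omega
  · have h0 := hgr.symm_ne _ _ hcc
    have aux : ∀ S : Line ℤ, S.slope ≠ c.slope → S.slope ≠ c'.slope →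
        gr S c' - gr S c = gr c c' ∨ gr S c' - gr S c = gr c c' + 1 := by
      intro S h1 h2
      rcases incr3_total S.slope c.slope c'.slope h1 h2 hcc with hi | hi
      · have := hgr.trans _ _ _ hi
        omega
      · have := hgr.trans _ _ _ hi
        omega
    have h1 := aux S hSc hSc'
    have h2 := aux T hTc hTc'
    omega

/-- If `Θ_ℤ(C)` is an interval, then `Θ_ℤ(C) = Θ_{ℤ/2}(C)`. -/
theorem statement9 (gr : Line ℤ → Line ℤ → ℤ) (hgr : IsGradingFunction gr)
    (gr2 : Line (ZMod 2) → Line (ZMod 2) → ZMod 2)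
    (hgr2 : IsGradingFunction gr2)
    (hcompat : ∀ c c' : Line ℤ, gr2 (redLine c) (redLine c') = ((gr c c' : ℤ) : ZMod 2))
    (C : Set (Line ℤ)) (hCfin : C.Finite) (hCne : C.Nonempty)
    (hint : IsInterval (Theta gr C)) :
    Theta gr C = Theta gr2 (redLine '' C) := by
  have hinf : (Theta gr C).Infinite := by
    obtain ⟨-, a, b, h | h | h | h⟩ := hint <;> rw [h] <;>
      refine (intvl_infinite a b).mono ?_ <;> intro x hx <;> simp [hx]
  have hred : ∀ s : QP1, (⟨s, 0, false⟩ : Line (ZMod 2)) = redLine ⟨s, 0, false⟩ := by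
    intro s
    simp [redLine]
  ext s
  constructor
  · rintro ⟨n, hn⟩
    refine ⟨(n : ZMod 2), ?_⟩
    rintro _ rfl _ ⟨d, hd, rfl⟩
    have := hn _ rfl d hd
    refine ⟨this.1, fun h => ?_⟩
    rw [hred, hcompat, this.2 h]
  · rintro ⟨n, hn⟩
    have hn' : ∀ d ∈ C, (s = d.slope → false ≠ d.eps) ∧
        (s ≠ d.slope → ((gr ⟨s, 0, false⟩ d : ℤ) : ZMod 2) = n) := by
      intro d hd
      have := hn _ rfl (redLine d) ⟨d, hd, rfl⟩
      refine ⟨this.1, fun h => ?_⟩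
      rw [← hcompat, ← hred]
      exact this.2 h
    obtain ⟨t, ht, htC⟩ := hinf.exists_notMem_finite ((hCfin.image Line.slope).insert s)
    obtain ⟨m, hm⟩ := ht
    have hts : s ≠ t := fun h => htC (Or.inl h.symm)
    have htd : ∀ d ∈ C, t ≠ d.slope := fun d hd h => htC (Or.inr ⟨d, hd, h.symm⟩)
    have main : ∀ c ∈ C, ∀ d ∈ C, s ≠ c.slope → s ≠ d.slope →
        gr ⟨s, 0, false⟩ c = gr ⟨s, 0, false⟩ d := by
      intro c hc d hd h1 h2
      have h3 : gr ⟨t, 0, false⟩ c = gr ⟨t, 0, false⟩ d := by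
        rw [(hm _ rfl c hc).2 (htd c hc), (hm _ rfl d hd).2 (htd d hd)]
      have h4 := grade_diff gr hgr ⟨s, 0, false⟩ ⟨t, 0, false⟩ c d h1 h2 (htd c hc)
        (htd d hd) hts h3
      have h5 := ((hn' c hc).2 h1).trans ((hn' d hd).2 h2).symm
      have h6 := (ZMod.intCast_eq_intCast_iff_dvd_sub _ _ 2).1 h5
      push_cast at h6
      omega
    by_cases hex : ∃ c ∈ C, s ≠ c.slope
    · obtain ⟨c, hc, hsc⟩ := hex
      refine ⟨gr ⟨s, 0, false⟩ c, ?_⟩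
      rintro _ rfl d hd
      exact ⟨(hn' d hd).1, fun h => main d hd c hc h hsc⟩
    · refine ⟨0, ?_⟩
      rintro _ rfl d hd
      exact ⟨(hn' d hd).1, fun h => absurd ⟨d, hd, h⟩ hex⟩
end

section
/- Let C ⊆ Curves_ℤ be a line set. If Θ_ℤ(C) = {s, s'} with s ≠ s', then Slopes_C = {s, s'} and Θ_{ℤ/2}(C) equals the closed interval [s,s'] or [s',s]. -/
open OnePoint

theorem incr_rot {a b c : QP1} (h : Incr3 a b c) : Incr3 b c a := by
  rcases a with _ | a <;> rcases b with _ | b <;> rcases c with _ | c <;>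
    simp only [Incr3] at h ⊢ <;> grind

theorem incr_asymm {a b c : QP1} (h : Incr3 a b c) : ¬ Incr3 a c b := by
  rcases a with _ | a <;> rcases b with _ | b <;> rcases c with _ | c <;>
    simp only [Incr3] at h ⊢ <;> grind

theorem incr_ne {a b c : QP1} (h : Incr3 a b c) : a ≠ b ∧ b ≠ c ∧ a ≠ c := by
  refine ⟨?_, ?_, ?_⟩ <;> rintro rfl
  · exact incr_asymm (incr_rot (incr_rot h)) (incr_rot (incr_rot h))
  · exact incr_asymm h h
  · exact incr_asymm (incr_rot h) (incr_rot h)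

theorem incr_total {a b c : QP1} (h1 : a ≠ b) (h2 : b ≠ c) (h3 : a ≠ c) :
    Incr3 a b c ∨ Incr3 a c b := by
  have key : ∀ x y : ℚ, (Option.some x : QP1) ≠ Option.some y → x ≠ y := by
    rintro x y h rfl; exact h rfl
  rcases a with _ | a <;> rcases b with _ | b <;> rcases c with _ | c <;>
    simp only [Incr3] <;> try exact absurd rfl (by assumption)
  · exact lt_or_gt_of_ne (key _ _ h2)
  · exact (lt_or_gt_of_ne (key _ _ h3)).symm
  · exact (lt_or_gt_of_ne (key _ _ h1))
  · have := key _ _ h1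
    have := key _ _ h2
    have := key _ _ h3
    grind

theorem incr_trans {a b c d : QP1} (h : Incr3 a b c) (h' : Incr3 a c d) : Incr3 a b d := by
  rcases a with _ | a <;> rcases b with _ | b <;> rcases c with _ | c <;> rcases d with _ | d <;>
    simp only [Incr3] at h h' ⊢ <;> grind

theorem incr_between (a b : QP1) (h : a ≠ b) : ∃ t, Incr3 a t b := by
  rcases a with _ | a <;> rcases b with _ | b
  · exact absurd rfl h
  · exact ⟨Option.some (b - 1), by simp [Incr3]⟩
  · exact ⟨Option.some (a + 1), by simp [Incr3]⟩
  · have hab : a ≠ b := by rintro rfl; exact h rfl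
    rcases lt_or_gt_of_ne hab with h | h
    · obtain ⟨t, h1, h2⟩ := exists_between h
      exact ⟨Option.some t, by simp only [Incr3]; grind⟩
    · exact ⟨Option.none, by simpa [Incr3] using h⟩

theorem incr_near (a b : QP1) (h : a ≠ b) (F : Set QP1) (hF : F.Finite) :
    ∃ t, Incr3 a t b ∧ ∀ f ∈ F, f ≠ a → Incr3 a t f := by
  induction F, hF using Set.Finite.induction_on with
  | empty =>
    obtain ⟨t, ht⟩ := incr_between a b h
    exact ⟨t, ht, by simp⟩
  | @insert x F hx hF ih =>
    obtain ⟨t, ht, hall⟩ := ih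
    by_cases hxa : x = a
    · exact ⟨t, ht, by grind⟩
    by_cases hxt : x = t ∨ Incr3 a x t
    · obtain ⟨u, hu⟩ := incr_between a x (Ne.symm hxa)
      have hut : Incr3 a u t := by
        rcases hxt with rfl | hxt
        · exact hu
        · exact incr_trans hu hxt
      refine ⟨u, incr_trans hut ht, ?_⟩
      rintro f (rfl | hf) hfa
      · exact hu
      · exact incr_trans hut (hall f hf hfa)
    · refine ⟨t, ht, ?_⟩
      rintro f (rfl | hf) hfa
      · have := incr_ne ht
        push Not at hxt
        rcases incr_total this.1 (Ne.symm hxt.1) (Ne.symm hfa) with h | h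
        · exact h
        · exact absurd h hxt.2
      · exact hall f hf hfa

/-- Strict linear order on slopes with minimum `s`. -/
def LtFrom (s d c : QP1) : Prop := c ≠ s ∧ (d = s ∨ Incr3 s d c)

open scoped Classical in
/-- The correction term. -/
noncomputable def corr (s d c : QP1) : ℤ := if LtFrom s d c then 1 else 0

theorem corr_base (s d : QP1) : corr s d s = 0 := by simp [corr, LtFrom]

theorem corr_left (s c : QP1) (h : c ≠ s) : corr s s c = 1 := by simp [corr, LtFrom, h]

theorem corr_incr {s d c : QP1} (h : Incr3 s d c) : corr s d c = 1 := by
  have := incr_ne h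
  simp [corr, LtFrom, h, this.2.2.symm]

theorem corr_incr' {s d c : QP1} (h : Incr3 s c d) : corr s d c = 0 := by
  have := incr_ne h
  simp [corr, LtFrom, incr_asymm h, this.2.2.symm]

theorem potential (gr : Line ℤ → Line ℤ → ℤ) (hgr : IsGradingFunction gr) (s : QP1) :
    ∃ φ : Line ℤ → ℤ, ∀ c d : Line ℤ, c.slope ≠ d.slope →
      gr c d = φ d - φ c - corr s d.slope c.slope := by
  classical
  obtain ⟨t, hts⟩ := exists_ne s
  set S : Line ℤ := ⟨s, 0, false⟩ with hS
  set T : Line ℤ := ⟨t, 0, false⟩ with hT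
  have base : ∀ c a : Line ℤ, c.slope = s → a.slope ≠ s → gr c a - gr S a = gr c T - gr S T := by
    intro c a hc ha
    by_cases hat : a.slope = t
    · by_contra hne
      obtain ⟨u, hu⟩ := incr_between s t hts.symm
      have h1 := hgr.trans c ⟨u, 0, false⟩ a (by simpa [hc, hat] using hu)
      have h2 := hgr.trans S ⟨u, 0, false⟩ a (by simpa [hS, hat] using hu)
      have h3 := hgr.trans c ⟨u, 0, false⟩ T (by simpa [hc, hT] using hu)
      have h4 := hgr.trans S ⟨u, 0, false⟩ T (by simpa [hS, hT] using hu)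
      omega
    · rcases incr_total (Ne.symm ha) hat hts.symm with h | h
      · have h1 := hgr.trans c a T (by simpa [hc] using h)
        have h2 := hgr.trans S a T (by simpa using h)
        omega
      · have h1 := hgr.trans c T a (by simpa [hc] using h)
        have h2 := hgr.trans S T a (by simpa using h)
        omega
  refine ⟨fun c => if c.slope = s then gr S T - gr c T else gr S c, ?_⟩
  intro c d hcd
  by_cases hc : c.slope = s
  · have hd : d.slope ≠ s := by rw [← hc]; exact hcd.symm
    have := base c d hc hd
    simp only [hc, hd, if_true, if_false, corr_base]
    omega
  · by_cases hd : d.slope = s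
    · have := base d c hd hc
      have h2 := hgr.symm_ne c d hcd
      simp only [hc, hd, if_true, if_false, corr_left _ _ hc]
      omega
    · simp only [hc, hd, if_false]
      rcases incr_total (Ne.symm hc) hcd (Ne.symm hd) with h | h
      · have := hgr.trans S c d h
        rw [corr_incr' h]; omega
      · have := hgr.trans S d c h
        have h2 := hgr.symm_ne c d hcd
        rw [corr_incr h]; omega

section
variable {gr : Line ℤ → Line ℤ → ℤ} {s : QP1} {φ : Line ℤ → ℤ}

theorem mem_theta_iff (hφ : ∀ c d : Line ℤ, c.slope ≠ d.slope →
      gr c d = φ d - φ c - corr s d.slope c.slope) (C : Set (Line ℤ)) (t : QP1) :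
    t ∈ Theta gr C ↔ ∃ n : ℤ, ∀ c ∈ C, (c.slope = t → c.eps = true) ∧
      (c.slope ≠ t → φ c - corr s c.slope t = n) := by
  simp only [Theta, ThinPair, Set.mem_ofPred_eq, Set.mem_singleton_iff, forall_eq]
  constructor
  · rintro ⟨n, hn⟩
    refine ⟨n + φ ⟨t, 0, false⟩, fun c hc => ⟨fun h => ?_, fun h => ?_⟩⟩
    · have := (hn c hc).1 h.symm
      simpa using this
    · have h1 := (hn c hc).2 h.symm
      have h2 := hφ ⟨t, 0, false⟩ c h.symm
      simp only at h2
      omega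
  · rintro ⟨n, hn⟩
    refine ⟨n - φ ⟨t, 0, false⟩, fun c hc => ⟨fun h => ?_, fun h => ?_⟩⟩
    · have := (hn c hc).1 h.symm
      simp [this]
    · have h1 := (hn c hc).2 h.symm
      have h2 := hφ ⟨t, 0, false⟩ c h
      simp only at h2
      omega

theorem mem_theta2_iff (hφ : ∀ c d : Line ℤ, c.slope ≠ d.slope →
      gr c d = φ d - φ c - corr s d.slope c.slope)
    (gr2 : Line (ZMod 2) → Line (ZMod 2) → ZMod 2)
    (hcompat : ∀ c c' : Line ℤ, gr2 (redLine c) (redLine c') = ((gr c c' : ℤ) : ZMod 2))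
    (C : Set (Line ℤ)) (t : QP1) :
    t ∈ Theta gr2 (redLine '' C) ↔ ∃ n : ZMod 2, ∀ c ∈ C, (c.slope = t → c.eps = true) ∧
      (c.slope ≠ t → ((φ c - corr s c.slope t : ℤ) : ZMod 2) = n) := by
  have hg : ∀ c : Line ℤ, t ≠ c.slope → gr2 ⟨t, 0, false⟩ (redLine c) =
      ((φ c - corr s c.slope t : ℤ) : ZMod 2) - (φ ⟨t, 0, false⟩ : ZMod 2) := by
    intro c hc
    have h1 := hcompat ⟨t, 0, false⟩ c
    have h2 : redLine ⟨t, 0, false⟩ = ⟨t, 0, false⟩ := by simp [redLine]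
    rw [h2, hφ _ _ hc] at h1
    rw [h1]; push_cast; ring
  simp only [Theta, ThinPair, Set.mem_ofPred_eq, Set.mem_singleton_iff, forall_eq,
    Set.forall_mem_image]
  constructor
  · rintro ⟨n, hn⟩
    refine ⟨n + φ ⟨t, 0, false⟩, fun c hc => ⟨fun h => ?_, fun h => ?_⟩⟩
    · have := (hn hc).1 h.symm
      simpa [redLine] using this
    · have h1 := (hn hc).2 h.symm
      rw [hg c h.symm] at h1
      rw [← h1]; ring
  · rintro ⟨n, hn⟩
    refine ⟨n - φ ⟨t, 0, false⟩, fun c hc => ⟨fun h => ?_, fun h => ?_⟩⟩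
    · have := (hn c hc).1 h.symm
      simp [redLine, this]
    · have h1 := (hn c hc).2 (Ne.symm h)
      rw [hg c h, h1]
end

theorem mem_slopes (gr : Line ℤ → Line ℤ → ℤ) (hgr : IsGradingFunction gr)
    (C : Set (Line ℤ)) (hCfin : C.Finite)
    (s s' : QP1) (hss : s ≠ s') (hTheta : Theta gr C = {s, s'}) : ∃ c ∈ C, c.slope = s := by
  by_contra hno
  push Not at hno
  obtain ⟨φ, hφ⟩ := potential gr hgr s
  have hs : s ∈ Theta gr C := by simp [hTheta]
  obtain ⟨n, hn⟩ := (mem_theta_iff hφ C s).1 hs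
  obtain ⟨t, ht, htF⟩ := incr_near s s' hss (Line.slope '' C) (hCfin.image _)
  have htt : t ∈ Theta gr C := by
    refine (mem_theta_iff hφ C t).2 ⟨n, fun c hc => ?_⟩
    have h1 := htF c.slope ⟨c, hc, rfl⟩ (hno c hc)
    have h2 := (hn c hc).2 (hno c hc)
    rw [corr_base] at h2
    refine ⟨fun h => absurd h.symm (incr_ne h1).2.1, fun _ => ?_⟩
    rw [corr_incr' h1]; exact h2
  rw [hTheta] at htt
  have := incr_ne ht
  rcases htt with h | h
  · exact this.1 h.symm
  · exact this.2.1 h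

theorem statement10 (gr : Line ℤ → Line ℤ → ℤ) (hgr : IsGradingFunction gr)
    (gr2 : Line (ZMod 2) → Line (ZMod 2) → ZMod 2)
    (hgr2 : IsGradingFunction gr2)
    (hcompat : ∀ c c' : Line ℤ, gr2 (redLine c) (redLine c') = ((gr c c' : ℤ) : ZMod 2))
    (C : Set (Line ℤ)) (hCfin : C.Finite) (hCne : C.Nonempty)
    (s s' : QP1) (hss : s ≠ s') (hTheta : Theta gr C = {s, s'}) :
    SlopesOf C = {s, s'} ∧
      (Theta gr2 (redLine '' C) = insert s (insert s' (Intvl s s')) ∨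
        Theta gr2 (redLine '' C) = insert s' (insert s (Intvl s' s))) := by
  classical
  obtain ⟨φ, hφ⟩ := potential gr hgr s
  have hs : s ∈ Theta gr C := by simp [hTheta]
  have hs' : s' ∈ Theta gr C := by simp [hTheta]
  have hout : ∀ t, t ≠ s → t ≠ s' → t ∉ Theta gr C := by
    intro t h1 h2; simp [hTheta, h1, h2]
  obtain ⟨cs, hcs, hcss⟩ := mem_slopes gr hgr C hCfin s s' hss hTheta
  obtain ⟨cs', hcs', hcss'⟩ := mem_slopes gr hgr C hCfin s' s hss.symm
    (by rw [hTheta, Set.pair_comm])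
  obtain ⟨n, hn⟩ := (mem_theta_iff hφ C s).1 hs
  obtain ⟨n', hn'⟩ := (mem_theta_iff hφ C s').1 hs'
  have hne : ∀ c ∈ C, c.slope ≠ s → φ c = n := by
    intro c hc h
    have := (hn c hc).2 h
    rw [corr_base] at this; omega
  have heq : ∀ c ∈ C, c.slope = s → φ c = n' + 1 := by
    intro c hc h
    have := (hn' c hc).2 (by rw [h]; exact hss)
    rw [h, corr_left _ _ hss.symm] at this; omega
  -- slopes
  have hslope : ∀ c ∈ C, c.slope = s ∨ c.slope = s' := by
    intro c hc
    by_contra hcon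
    push Not at hcon
    obtain ⟨h1, h2⟩ := hcon
    have hc0 := hne c hc h1
    have hc1 := (hn' c hc).2 h2
    by_cases hex : ∃ d ∈ C, Incr3 s s' d.slope
    · obtain ⟨d, hd, hds⟩ := hex
      have hd0 := hne d hd (incr_ne hds).2.2.symm
      have hd1 := (hn' d hd).2 (incr_ne hds).2.1.symm
      rw [corr_incr' hds] at hd1
      obtain ⟨t, ht, htF⟩ := incr_near s s' hss (Line.slope '' C) (hCfin.image _)
      have := incr_ne ht
      refine hout t this.1.symm this.2.1 ((mem_theta_iff hφ C t).2 ⟨n, fun e he => ?_⟩)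
      by_cases hes : e.slope = s
      · refine ⟨fun h => absurd (hes.symm.trans h) this.1, fun _ => ?_⟩
        rw [hes, corr_left _ _ this.1.symm, heq e he hes]; omega
      · have h3 := htF e.slope ⟨e, he, rfl⟩ hes
        refine ⟨fun h => absurd h.symm (incr_ne h3).2.1, fun _ => ?_⟩
        rw [corr_incr' h3, hne e he hes]; omega
    · push Not at hex
      have hc2 : Incr3 s c.slope s' := by
        rcases incr_total (Ne.symm h1) h2 hss with h | h
        · exact h
        · exact absurd h (hex c hc)
      rw [corr_incr hc2] at hc1
      obtain ⟨t, ht⟩ := incr_between s' s hss.symm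
      have ht' : Incr3 s s' t := incr_rot (incr_rot ht)
      have := incr_ne ht'
      refine hout t this.2.2.symm this.2.1.symm
        ((mem_theta_iff hφ C t).2 ⟨n - 1, fun e he => ?_⟩)
      by_cases hes : e.slope = s
      · refine ⟨fun h => absurd (hes.symm.trans h) this.2.2, fun _ => ?_⟩
        rw [hes, corr_left _ _ this.2.2.symm, heq e he hes]; omega
      · have h3 : Incr3 s e.slope t := by
          by_cases hes' : e.slope = s'
          · rw [hes']; exact ht'
          · rcases incr_total (Ne.symm hes) hes' hss with h | h
            · exact incr_trans h ht'
            · exact absurd h (hex e he)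
        refine ⟨fun h => absurd h (incr_ne h3).2.1, fun _ => ?_⟩
        rw [corr_incr h3, hne e he hes]
  refine ⟨?_, ?_⟩
  · ext x
    constructor
    · rintro ⟨c, hc, rfl⟩
      exact hslope c hc
    · rintro (rfl | rfl)
      · exact ⟨cs, hcs, hcss⟩
      · exact ⟨cs', hcs', hcss'⟩
  · have m1 : s ∈ Theta gr2 (redLine '' C) :=
      (mem_theta2_iff hφ gr2 hcompat C s).2 ⟨n, fun c hc => ⟨(hn c hc).1, fun h => by
        rw [(hn c hc).2 h]⟩⟩
    have m2 : s' ∈ Theta gr2 (redLine '' C) :=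
      (mem_theta2_iff hφ gr2 hcompat C s').2 ⟨n', fun c hc => ⟨(hn' c hc).1, fun h => by
        rw [(hn' c hc).2 h]⟩⟩
    have m3 : ∀ t, Incr3 s t s' →
        (t ∈ Theta gr2 (redLine '' C) ↔ ((n' : ℤ) : ZMod 2) = ((n : ℤ) : ZMod 2)) := by
      intro t ht
      have := incr_ne ht
      rw [mem_theta2_iff hφ gr2 hcompat]
      constructor
      · rintro ⟨k, hk⟩
        have k1 := (hk cs hcs).2 (by rw [hcss]; exact this.1)
        have k2 := (hk cs' hcs').2 (by rw [hcss']; exact this.2.1.symm)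
        rw [hcss, corr_left _ _ this.1.symm, heq cs hcs hcss] at k1
        rw [hcss', corr_incr' ht, hne cs' hcs' (by rw [hcss']; exact hss.symm)] at k2
        simpa using k1.trans k2.symm
      · intro hk
        refine ⟨n, fun e he => ?_⟩
        rcases hslope e he with hes | hes
        · refine ⟨fun h => absurd (hes.symm.trans h) this.1, fun _ => ?_⟩
          rw [hes, corr_left _ _ this.1.symm, heq e he hes, ← hk]; simp
        · refine ⟨fun h => absurd (h.symm.trans hes) this.2.1, fun _ => ?_⟩
          rw [hne e he (by rw [hes]; exact hss.symm), hes, corr_incr' ht]; simp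
    have m4 : ∀ t, Incr3 s s' t →
        (t ∈ Theta gr2 (redLine '' C) ↔ ((n' : ℤ) : ZMod 2) = ((n : ℤ) : ZMod 2) - 1) := by
      intro t ht
      have := incr_ne ht
      rw [mem_theta2_iff hφ gr2 hcompat]
      constructor
      · rintro ⟨k, hk⟩
        have k1 := (hk cs hcs).2 (by rw [hcss]; exact this.2.2)
        have k2 := (hk cs' hcs').2 (by rw [hcss']; exact this.2.1)
        rw [hcss, corr_left _ _ this.2.2.symm, heq cs hcs hcss] at k1
        rw [hcss', corr_incr ht, hne cs' hcs' (by rw [hcss']; exact hss.symm)] at k2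
        simpa using k1.trans k2.symm
      · intro hk
        refine ⟨n - 1, fun e he => ?_⟩
        rcases hslope e he with hes | hes
        · refine ⟨fun h => absurd (hes.symm.trans h) this.2.2, fun _ => ?_⟩
          rw [hes, corr_left _ _ this.2.2.symm, heq e he hes, ← hk]; simp
        · refine ⟨fun h => absurd (hes.symm.trans h) this.2.1, fun _ => ?_⟩
          rw [hne e he (by rw [hes]; exact hss.symm), hes, corr_incr ht]; simp
    have par : ∀ a b : ZMod 2, (a = b ∧ ¬ a = b - 1) ∨ (¬ a = b ∧ a = b - 1) := by decide
    have hI : ∀ t, t ∈ Intvl s s' ↔ Incr3 s t s' := by intro t; simp [Intvl, hss]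
    have hI' : ∀ t, t ∈ Intvl s' s ↔ Incr3 s s' t := by
      intro t
      simp only [Intvl, hss.symm, if_false, Set.mem_ofPred_eq]
      exact ⟨fun h => incr_rot (incr_rot h), fun h => incr_rot h⟩
    rcases par (n' : ZMod 2) (n : ZMod 2) with ⟨p1, p2⟩ | ⟨p1, p2⟩
    · left
      ext t
      rw [Set.mem_insert_iff, Set.mem_insert_iff, hI]
      by_cases h1 : t = s
      · subst h1; simp [m1]
      by_cases h2 : t = s'
      · subst h2; simp [m2]
      rcases incr_total (Ne.symm h1) h2 hss with h | h
      · simp [m3 t h, p1, h]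
      · simp [m4 t h, p2, h1, h2, incr_asymm h]
    · right
      ext t
      rw [Set.mem_insert_iff, Set.mem_insert_iff, hI']
      by_cases h1 : t = s
      · subst h1; simp [m1]
      by_cases h2 : t = s'
      · subst h2; simp [m2]
      rcases incr_total (Ne.symm h1) h2 hss with h | h
      · simp [m3 t h, p1, h1, h2, incr_asymm h]
      · rw [m4 t h]; simp [p2, h]
end
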